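/- Let d ≥ 2 be an integer, ξ a random vector in ℝ^d with density f, θ ∈ ℝ^d with θ ≠ 0, and y ∈ ℝ^d with ‖y‖ ≤ 1. Set A = (θ+ξ)/‖θ+ξ‖ (defined almost surely), Q = E[A Aᵀ] (nonsingular), ŷ = Q⁻¹ A ⟨y,A⟩, and H = ((√(1+‖θ‖²) − 1)/‖θ‖²) · (I_d − p_θ) + ((√(1+‖θ‖²) − 1)/(‖θ‖² √(1+‖θ‖²))) · p_θ with p_θ = θθᵀ/‖θ‖² (H is the Hessian at θ of the Fenchel conjugate R* of R(z) = −ln(1−‖z‖²)). Then: (1) E[ŷᵀ H ŷ] ≤ (3/2) d²; (2) almost surely ŷᵀ H ŷ ≤ d² ‖θ‖ + 4 d²; and (3) E[‖ŷ‖²] ≤ d² ‖θ‖ + 2 d². -/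

import Mathlib

noncomputable section
open MeasureTheory ProbabilityTheory Real Matrix
open scoped RealInnerProductSpace

/-- `E d` is the Euclidean space `ℝ^d`. -/
abbrev E (d : ℕ) : Type := EuclideanSpace ℝ (Fin d)

/-- The radial profile `f̃` of the ball perturbation density: `fball d x = ftilde d ‖x‖`. -/
def ftilde (d : ℕ) (r : ℝ) : ℝ :=
  (Real.Gamma ((d : ℝ) + 1/2) / (2 * Real.pi ^ ((d : ℝ)/2) * Real.Gamma (((d : ℝ) + 1)/2))) *
    ∫ t in (0:ℝ)..1, t ^ (((d : ℝ) - 1)/2) * (1 + t * r^2) ^ (-(d : ℝ) - 1/2)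

/-- The density on `ℝ^d` of the self-concordant perturbation for the Euclidean ball. -/
def fball (d : ℕ) (x : E d) : ℝ := ftilde d ‖x‖

/-- The ball perturbation, as a measure on `ℝ^d`. -/
def ballPert (d : ℕ) : Measure (E d) :=
  volume.withDensity fun x => ENNReal.ofReal (fball d x)

/-- `S_n = 2 π^{(n+1)/2} / Γ((n+1)/2)`, the surface area of the unit `n`-sphere. -/
def sphereArea (n : ℕ) : ℝ := 2 * Real.pi ^ (((n : ℝ) + 1)/2) / Real.Gamma (((n : ℝ) + 1)/2)

/-- `K(x) = S_{d−2} ∫₀^∞ (∫₀^π sin^d φ/(r²+x²+2rx cos φ) dφ) f̃(r) r^{d+1} dr`. -/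
def Kfun (d : ℕ) (x : ℝ) : ℝ :=
  sphereArea (d-2) * ∫ r in Set.Ioi (0:ℝ),
    (∫ φ in (0:ℝ)..Real.pi, (Real.sin φ)^d / (r^2 + x^2 + 2*r*x*Real.cos φ)) *
      ftilde d r * r^(d+1)

/-- The profile `(1 + r²)^(-d-1/2)` of the (unnormalised) multivariate `t`-distribution that
`ballPert d` is a scale mixture of. -/
def studentProfile (d : ℕ) (r : ℝ) : ℝ := (1 + r ^ 2) ^ (-(d : ℝ) - 1 / 2)

lemma studentProfile_nonneg (d : ℕ) (r : ℝ) : 0 ≤ studentProfile d r := by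
  unfold studentProfile; positivity

lemma continuous_studentProfile (d : ℕ) : Continuous (studentProfile d) := by
  unfold studentProfile
  exact Continuous.rpow_const (by fun_prop) fun r => Or.inl (by positivity)

lemma integrableOn_pow_mul_studentProfile {d m : ℕ} (hd : 2 ≤ d) (hm : m ≤ d + 1) :
    IntegrableOn (fun r : ℝ => r ^ m * studentProfile d r) (Set.Ioi 0) := by
  refine Integrable.mono' (g := fun r : ℝ => (1 + r ^ 2)⁻¹) integrable_inv_one_add_sq.integrableOn
    (by have := continuous_studentProfile d; fun_prop) ?_
  filter_upwards [ae_restrict_mem measurableSet_Ioi] with r hr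
  have hr0 : 0 < r := hr
  have h1 : 1 ≤ 1 + r ^ 2 := by nlinarith
  have h0 : 0 < 1 + r ^ 2 := by linarith
  have hd' : (2 : ℝ) ≤ d := by exact_mod_cast hd
  rw [Real.norm_of_nonneg (mul_nonneg (by positivity) (studentProfile_nonneg d r))]
  have h2 : r ^ m ≤ (1 + r ^ 2) ^ (((d : ℝ) + 1) / 2) := by
    calc r ^ m = (r ^ 2) ^ ((m : ℝ) / 2) := by
          rw [← Real.rpow_natCast r 2, ← Real.rpow_mul hr0.le, ← Real.rpow_natCast]
          congr 1; push_cast; ring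
      _ ≤ (1 + r ^ 2) ^ ((m : ℝ) / 2) :=
          Real.rpow_le_rpow (by positivity) (by linarith) (by positivity)
      _ ≤ _ := by
          refine Real.rpow_le_rpow_of_exponent_le h1 ?_
          have : (m : ℝ) ≤ d + 1 := by exact_mod_cast hm
          linarith
  calc r ^ m * studentProfile d r
      ≤ (1 + r ^ 2) ^ (((d : ℝ) + 1) / 2) * (1 + r ^ 2) ^ (-(d : ℝ) - 1 / 2) :=
        mul_le_mul_of_nonneg_right h2 (studentProfile_nonneg d r)
    _ = (1 + r ^ 2) ^ (-((d : ℝ) / 2)) := by rw [← Real.rpow_add h0]; congr 1; ring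
    _ ≤ (1 + r ^ 2) ^ (-1 : ℝ) := Real.rpow_le_rpow_of_exponent_le h1 (by linarith)
    _ = (1 + r ^ 2)⁻¹ := Real.rpow_neg_one _

lemma studentProfile_inv {r : ℝ} (d : ℕ) (hr : 0 < r) :
    studentProfile d r⁻¹ = r ^ (2 * d + 1) * studentProfile d r := by
  unfold studentProfile
  have h : 1 + r⁻¹ ^ 2 = (1 + r ^ 2) * (r ^ 2)⁻¹ := by field_simp; ring
  rw [h, Real.mul_rpow (by positivity) (by positivity), Real.inv_rpow (by positivity),
    ← Real.rpow_neg (by positivity), ← Real.rpow_natCast r 2, ← Real.rpow_mul hr.le, mul_comm,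
    ← Real.rpow_natCast r (2 * d + 1)]
  congr 2; push_cast; ring

/-- The inversion `r ↦ 1/r` exchanges the zeroth and the first radial moment. -/
lemma integral_pow_mul_studentProfile_inversion {d : ℕ} (hd : 2 ≤ d) :
    ∫ r in Set.Ioi (0 : ℝ), r ^ d * studentProfile d r =
      ∫ r in Set.Ioi (0 : ℝ), r ^ (d - 1) * studentProfile d r := by
  rw [← integral_comp_rpow_Ioi (fun r : ℝ => r ^ (d - 1) * studentProfile d r)
    (p := -1) (by norm_num)]
  refine setIntegral_congr_fun measurableSet_Ioi fun r hr => ?_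
  have hr0 : (0 : ℝ) < r := hr
  obtain ⟨k, rfl⟩ : ∃ k, d = k + 1 := ⟨d - 1, by omega⟩
  have h2 : r ^ (-1 - 1 : ℝ) = (r ^ 2)⁻¹ := by
    rw [show (-1 - 1 : ℝ) = -((2 : ℕ) : ℝ) by norm_num, Real.rpow_neg hr0.le, Real.rpow_natCast]
  simp only [smul_eq_mul, abs_neg, abs_one, one_mul, Real.rpow_neg_one, h2, Nat.add_sub_cancel]
  rw [studentProfile_inv _ hr0, inv_pow]
  field_simp
  ring

lemma integral_pow_mul_studentProfile_rec {d : ℕ} (hd : 2 ≤ d) :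
    (d : ℝ) * ∫ r in Set.Ioi (0 : ℝ), r ^ (d - 1) * studentProfile d r =
      ((d : ℝ) - 1) * ∫ r in Set.Ioi (0 : ℝ), r ^ (d + 1) * studentProfile d r := by
  have hi0 := (integrableOn_pow_mul_studentProfile hd (m := d - 1) (by omega)).const_mul (d : ℝ)
  have hi2 := (integrableOn_pow_mul_studentProfile hd (m := d + 1) le_rfl).const_mul ((d : ℝ) - 1)
  rw [← sub_eq_zero, ← integral_const_mul, ← integral_const_mul, ← integral_sub hi0 hi2]
  have hd' : (2 : ℝ) ≤ d := by exact_mod_cast hd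
  have key := integral_Ioi_of_hasDerivAt_of_tendsto (a := (0 : ℝ)) (m := (0 : ℝ))
    (f := fun r : ℝ => r ^ d * (1 + r ^ 2) ^ (-(d : ℝ) + 1 / 2))
    (f' := fun r : ℝ => d * (r ^ (d - 1) * studentProfile d r) -
      ((d : ℝ) - 1) * (r ^ (d + 1) * studentProfile d r)) ?_ ?_ (hi0.sub hi2) ?_
  · rw [key]; simp; omega
  · refine Continuous.continuousWithinAt ?_
    exact (continuous_pow d).mul
      (Continuous.rpow_const (by fun_prop) fun r => Or.inl (by positivity))
  · intro r hr
    have h0 : 0 < 1 + r ^ 2 := by positivity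
    have hq : HasDerivAt (fun r : ℝ => 1 + r ^ 2) (2 * r) r := by
      simpa using (hasDerivAt_pow 2 r).const_add 1
    have := (hasDerivAt_pow d r).mul (hq.rpow_const (p := -(d : ℝ) + 1 / 2) (Or.inl h0.ne'))
    refine this.congr_deriv ?_
    have e1 : (1 + r ^ 2) ^ (-(d : ℝ) + 1 / 2) = studentProfile d r * (1 + r ^ 2) := by
      unfold studentProfile
      rw [← Real.rpow_add_one h0.ne']; congr 1; ring
    have e2 : (1 + r ^ 2) ^ (-(d : ℝ) + 1 / 2 - 1) = studentProfile d r := by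
      unfold studentProfile; congr 1; ring
    rw [e1, e2]
    obtain ⟨k, rfl⟩ : ∃ k, d = k + 1 := ⟨d - 1, by omega⟩
    push_cast
    ring
  · refine squeeze_zero' (g := fun r : ℝ => r⁻¹) ?_ ?_ tendsto_inv_atTop_zero
    · filter_upwards [Filter.eventually_gt_atTop 0] with r hr
      positivity
    · filter_upwards [Filter.eventually_ge_atTop 1] with r hr
      have hr0 : 0 < r := by linarith
      calc r ^ d * (1 + r ^ 2) ^ (-(d : ℝ) + 1 / 2)
          ≤ r ^ d * (r ^ 2) ^ (-(d : ℝ) + 1 / 2) := by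
            refine mul_le_mul_of_nonneg_left ?_ (by positivity)
            exact Real.rpow_le_rpow_of_nonpos (by positivity) (by linarith) (by linarith)
        _ = r ^ (1 - d : ℝ) := by
            rw [← Real.rpow_natCast r 2, ← Real.rpow_mul hr0.le, ← Real.rpow_natCast r d,
              ← Real.rpow_add hr0]
            congr 1; push_cast; ring
        _ ≤ r ^ (-1 : ℝ) := Real.rpow_le_rpow_of_exponent_le hr (by linarith)
        _ = r⁻¹ := Real.rpow_neg_one r

lemma nontrivial_E {d : ℕ} (hd : 2 ≤ d) : Nontrivial (E d) := by
  have : Nonempty (Fin d) := ⟨⟨0, by omega⟩⟩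
  infer_instance

lemma integrable_norm_pow_mul_studentProfile {d k : ℕ} (hd : 2 ≤ d) (hk : k ≤ 2) :
    Integrable (fun X : E d => ‖X‖ ^ k * studentProfile d ‖X‖) := by
  have := nontrivial_E hd
  rw [integrable_fun_norm_addHaar volume (f := fun r => r ^ k * studentProfile d r)]
  refine (integrableOn_pow_mul_studentProfile hd (m := d - 1 + k) (by omega)).congr_fun
    (fun r _ => ?_) measurableSet_Ioi
  simp [pow_add, mul_assoc]

lemma integral_norm_pow_mul_studentProfile {d : ℕ} (hd : 2 ≤ d) (k : ℕ) :
    ∫ X : E d, ‖X‖ ^ k * studentProfile d ‖X‖ =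
      d * (volume.real (Metric.ball (0 : E d) 1) *
        ∫ r in Set.Ioi (0 : ℝ), r ^ (d - 1 + k) * studentProfile d r) := by
  have := nontrivial_E hd
  rw [integral_fun_norm_addHaar volume (fun r => r ^ k * studentProfile d r)]
  simp [pow_add, mul_assoc]

lemma integral_norm_mul_studentProfile {d : ℕ} (hd : 2 ≤ d) :
    ∫ X : E d, ‖X‖ * studentProfile d ‖X‖ = ∫ X : E d, studentProfile d ‖X‖ := by
  have h0 := integral_norm_pow_mul_studentProfile hd 0
  have h1 := integral_norm_pow_mul_studentProfile hd 1
  simp only [pow_zero, pow_one, one_mul, add_zero] at h0 h1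
  rw [h0, h1, show d - 1 + 1 = d by omega, integral_pow_mul_studentProfile_inversion hd]

lemma integral_norm_sq_mul_studentProfile_le {d : ℕ} (hd : 2 ≤ d) :
    ∫ X : E d, ‖X‖ ^ 2 * studentProfile d ‖X‖ ≤ 2 * ∫ X : E d, studentProfile d ‖X‖ := by
  have h0 := integral_norm_pow_mul_studentProfile hd 0
  simp only [pow_zero, one_mul, add_zero] at h0
  rw [h0, integral_norm_pow_mul_studentProfile hd 2, show d - 1 + 2 = d + 1 by omega]
  have hrec := integral_pow_mul_studentProfile_rec hd
  have hd' : (2 : ℝ) ≤ d := by exact_mod_cast hd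
  have hnn : 0 ≤ ∫ r in Set.Ioi (0 : ℝ), r ^ (d + 1) * studentProfile d r :=
    setIntegral_nonneg measurableSet_Ioi fun r hr =>
      mul_nonneg (pow_nonneg (le_of_lt hr) _) (studentProfile_nonneg d r)
  have hle : ∫ r in Set.Ioi (0 : ℝ), r ^ (d + 1) * studentProfile d r ≤
      2 * ∫ r in Set.Ioi (0 : ℝ), r ^ (d - 1) * studentProfile d r := by
    nlinarith
  have hv : 0 ≤ volume.real (Metric.ball (0 : E d) 1) := measureReal_nonneg
  have := mul_le_mul_of_nonneg_left (mul_le_mul_of_nonneg_left hle hv) (Nat.cast_nonneg (α := ℝ) d)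
  linarith

/-- Since the first moment is the mass and the second at most twice the mass, the tangent line of
`r ↦ 1 / (r + x)` at `r = 2` bounds this integral from below. -/
lemma le_integral_norm_div_mul_studentProfile {d : ℕ} (hd : 2 ≤ d) {x : ℝ} (hx : 0 < x) :
    (∫ X : E d, studentProfile d ‖X‖) / (x + 2) ≤
      ∫ X : E d, ‖X‖ / (‖X‖ + x) * studentProfile d ‖X‖ := by
  have i1 := integrable_norm_pow_mul_studentProfile hd (k := 1) (by norm_num)
  have i2 := integrable_norm_pow_mul_studentProfile hd (k := 2) le_rfl
  have i0 := integrable_norm_pow_mul_studentProfile hd (k := 0) (by norm_num)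
  simp only [pow_zero, pow_one, one_mul] at i0 i1
  have h1 := integral_norm_mul_studentProfile hd
  have h2 := integral_norm_sq_mul_studentProfile_le hd
  have i3 : Integrable (fun X : E d => ‖X‖ / (‖X‖ + x) * studentProfile d ‖X‖) := by
    refine i0.mono' ?_ (ae_of_all _ fun X => ?_)
    · have := continuous_studentProfile d
      refine Continuous.aestronglyMeasurable ?_
      refine (continuous_norm.div₀ (by fun_prop) fun X => ?_).mul (by fun_prop)
      positivity
    · have hp := studentProfile_nonneg d ‖X‖
      rw [Real.norm_of_nonneg (by positivity)]
      refine mul_le_of_le_one_left hp ?_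
      rw [div_le_one (by positivity)]; linarith
  have hx2 : 0 < x + 2 := by linarith
  have hmono := integral_mono
    ((i1.const_mul ((x + 4) / (x + 2) ^ 2)).sub (i2.const_mul (1 / (x + 2) ^ 2))) i3 (fun X => by
      have hp := studentProfile_nonneg d ‖X‖
      have hn := norm_nonneg X
      simp only [Pi.sub_apply]
      rw [← mul_assoc, ← mul_assoc, ← sub_mul]
      refine mul_le_mul_of_nonneg_right ?_ hp
      rw [← sub_nonneg]
      have : ‖X‖ / (‖X‖ + x) - ((x + 4) / (x + 2) ^ 2 * ‖X‖ - 1 / (x + 2) ^ 2 * ‖X‖ ^ 2) =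
          ‖X‖ * (‖X‖ - 2) ^ 2 / ((‖X‖ + x) * (x + 2) ^ 2) := by
        field_simp; ring
      rw [this]; positivity)
  refine le_trans ?_ hmono
  rw [integral_sub' (i1.const_mul _) (i2.const_mul _), integral_const_mul, integral_const_mul, h1]
  have := mul_le_mul_of_nonneg_left h2 (by positivity : 0 ≤ 1 / (x + 2) ^ 2)
  calc (∫ X : E d, studentProfile d ‖X‖) / (x + 2)
      = (x + 4) / (x + 2) ^ 2 * (∫ X : E d, studentProfile d ‖X‖) -
        1 / (x + 2) ^ 2 * (2 * ∫ X : E d, studentProfile d ‖X‖) := by field_simp; ring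
    _ ≤ _ := by linarith

/-- The normalising constant in `ftilde`. -/
def ftildeConst (d : ℕ) : ℝ :=
  Real.Gamma ((d : ℝ) + 1/2) / (2 * Real.pi ^ ((d : ℝ)/2) * Real.Gamma (((d : ℝ) + 1)/2))

lemma ftildeConst_nonneg (d : ℕ) : 0 ≤ ftildeConst d := by
  unfold ftildeConst
  have h1 := Real.Gamma_nonneg_of_nonneg (by positivity : (0 : ℝ) ≤ (d : ℝ) + 1 / 2)
  have h2 := Real.Gamma_nonneg_of_nonneg (by positivity : (0 : ℝ) ≤ ((d : ℝ) + 1) / 2)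
  positivity

/-- Substituting `t = u²` in the definition of `ftilde`. -/
lemma ftilde_eq {d : ℕ} (hd : 2 ≤ d) (r : ℝ) :
    ftilde d r = ∫ u in (0 : ℝ)..1, 2 * ftildeConst d * (u ^ d * studentProfile d (u * r)) := by
  have hd' : (2 : ℝ) ≤ d := by exact_mod_cast hd
  have hsub := intervalIntegral.integral_comp_mul_deriv'' (a := (0 : ℝ)) (b := 1)
    (f := fun u : ℝ => u ^ 2) (f' := fun u : ℝ => 2 * u)
    (g := fun t : ℝ => t ^ (((d : ℝ) - 1)/2) * (1 + t * r^2) ^ (-(d : ℝ) - 1/2))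
    (by fun_prop) (fun u _ => by simpa using (hasDerivAt_pow 2 u).hasDerivWithinAt)
    (by fun_prop) (by
      refine ContinuousOn.mul ?_ ?_
      · exact (Real.continuous_rpow_const (by linarith)).continuousOn
      · refine ContinuousOn.rpow_const (by fun_prop) ?_
        rintro _ ⟨u, _, rfl⟩
        left; positivity)
  simp only [Function.comp_apply, zero_pow two_ne_zero, one_pow] at hsub
  rw [intervalIntegral.integral_const_mul, mul_comm 2, mul_assoc]
  unfold ftilde
  rw [← hsub, ← ftildeConst, ← intervalIntegral.integral_const_mul 2]
  refine congrArg (ftildeConst d * ·) (intervalIntegral.integral_congr fun u hu => ?_)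
  rw [Set.uIcc_of_le zero_le_one] at hu
  have hu0 : 0 ≤ u := hu.1
  have e : (u ^ 2) ^ (((d : ℝ) - 1) / 2) = u ^ (d - 1) := by
    rw [← Real.rpow_natCast u 2, ← Real.rpow_mul hu0, ← Real.rpow_natCast u (d - 1),
      Nat.cast_sub (by omega)]
    congr 1; push_cast; ring
  simp only [e, studentProfile, mul_pow]
  obtain ⟨k, rfl⟩ : ∃ k, d = k + 1 := ⟨d - 1, by omega⟩
  simp only [Nat.add_sub_cancel]
  ring

lemma ofReal_fball_eq {d : ℕ} (hd : 2 ≤ d) (x : E d) :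
    ENNReal.ofReal (fball d x) = ∫⁻ u in Set.Ioc (0 : ℝ) 1,
      ENNReal.ofReal (2 * ftildeConst d * (u ^ d * studentProfile d (u * ‖x‖))) := by
  have hc := continuous_studentProfile d
  rw [fball, ftilde_eq hd, intervalIntegral.integral_of_le zero_le_one,
    ofReal_integral_eq_lintegral_ofReal]
  · refine (Continuous.integrableOn_Icc ?_).mono_set Set.Ioc_subset_Icc_self
    fun_prop
  · filter_upwards [ae_restrict_mem measurableSet_Ioc] with u hu
    have h1 := ftildeConst_nonneg d
    have h2 := studentProfile_nonneg d (u * ‖x‖)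
    have h3 := hu.1.le
    simp only [Pi.zero_apply]
    positivity

lemma measurable_ofReal_fball {d : ℕ} (hd : 2 ≤ d) :
    Measurable fun x : E d => ENNReal.ofReal (fball d x) := by
  have hc := continuous_studentProfile d
  simp_rw [ofReal_fball_eq hd]
  have hm : Measurable fun p : E d × ℝ =>
      ENNReal.ofReal (2 * ftildeConst d * (p.2 ^ d * studentProfile d (p.2 * ‖p.1‖))) := by
    refine ENNReal.measurable_ofReal.comp (Continuous.measurable ?_)
    fun_prop
  exact hm.lintegral_prod_right'

lemma lintegral_eq_lintegral_inv_smul {d : ℕ} {u : ℝ} (hu : 0 < u) {g : E d → ENNReal}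
    (hg : Measurable g) :
    ∫⁻ x, ENNReal.ofReal (u ^ d) * g x = ∫⁻ X, g (u⁻¹ • X) := by
  have h := Measure.map_addHaar_smul (volume : Measure (E d)) (r := u⁻¹) (inv_ne_zero hu.ne')
  rw [← lintegral_map hg (measurable_const_smul u⁻¹), h, lintegral_smul_measure,
    lintegral_const_mul _ hg]
  simp [abs_of_pos hu]

/-- A vector with law `ballPert d` is `X / U` with `U` uniform on `(0, 1]` and `X` an independent
vector with density proportional to `studentProfile d ‖X‖`. -/
lemma lintegral_ballPert {d : ℕ} (hd : 2 ≤ d) {G : E d → ENNReal} (hG : Measurable G) :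
    ∫⁻ x, G x ∂(ballPert d) = ∫⁻ X : E d,
      ENNReal.ofReal (2 * ftildeConst d * studentProfile d ‖X‖) *
        ∫⁻ u in Set.Ioc (0 : ℝ) 1, G (u⁻¹ • X) := by
  have hc := continuous_studentProfile d
  have hm : Measurable fun p : E d × ℝ =>
      ENNReal.ofReal (2 * ftildeConst d * (p.2 ^ d * studentProfile d (p.2 * ‖p.1‖))) := by
    refine ENNReal.measurable_ofReal.comp (Continuous.measurable ?_)
    fun_prop
  have hm2 : Measurable fun p : E d × ℝ => G (p.2⁻¹ • p.1) :=
    hG.comp (measurable_snd.inv.smul measurable_fst)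
  have hm3 : Measurable fun X : E d =>
      ENNReal.ofReal (2 * ftildeConst d * studentProfile d ‖X‖) := by
    refine ENNReal.measurable_ofReal.comp (Continuous.measurable ?_)
    fun_prop
  calc ∫⁻ x, G x ∂(ballPert d)
      = ∫⁻ x : E d, ∫⁻ u in Set.Ioc (0 : ℝ) 1, ENNReal.ofReal
          (2 * ftildeConst d * (u ^ d * studentProfile d (u * ‖x‖))) * G x := by
        rw [ballPert, lintegral_withDensity_eq_lintegral_mul _ (measurable_ofReal_fball hd) hG]
        refine lintegral_congr fun x => ?_
        rw [Pi.mul_apply, ofReal_fball_eq hd, lintegral_mul_const]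
        exact hm.comp measurable_prodMk_left
    _ = ∫⁻ u in Set.Ioc (0 : ℝ) 1, ∫⁻ x : E d, ENNReal.ofReal
          (2 * ftildeConst d * (u ^ d * studentProfile d (u * ‖x‖))) * G x :=
        lintegral_lintegral_swap (hm.mul (hG.comp measurable_fst)).aemeasurable
    _ = ∫⁻ u in Set.Ioc (0 : ℝ) 1, ∫⁻ X : E d, ENNReal.ofReal
          (2 * ftildeConst d * studentProfile d ‖X‖) * G (u⁻¹ • X) := by
        refine setLIntegral_congr_fun measurableSet_Ioc fun u hu => ?_
        have hu0 : 0 < u := hu.1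
        have := lintegral_eq_lintegral_inv_smul hu0 (d := d) (g := fun x =>
          ENNReal.ofReal (2 * ftildeConst d * studentProfile d (u * ‖x‖)) * G x) (by
            refine Measurable.mul ?_ hG
            refine ENNReal.measurable_ofReal.comp (Continuous.measurable ?_)
            fun_prop)
        convert this using 1
        · refine lintegral_congr fun x => ?_
          rw [← mul_assoc (ENNReal.ofReal (u ^ d)), ← ENNReal.ofReal_mul (by positivity)]
          congr 2; ring
        · refine lintegral_congr fun X => ?_
          rw [norm_smul, Real.norm_of_nonneg (by positivity), mul_inv_cancel_left₀ hu0.ne']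
    _ = ∫⁻ X : E d, ∫⁻ u in Set.Ioc (0 : ℝ) 1, ENNReal.ofReal
          (2 * ftildeConst d * studentProfile d ‖X‖) * G (u⁻¹ • X) := by
        refine (lintegral_lintegral_swap (f := fun X u => ENNReal.ofReal
          (2 * ftildeConst d * studentProfile d ‖X‖) * G (u⁻¹ • X)) ?_).symm
        exact ((hm3.comp measurable_fst).mul hm2).aemeasurable
    _ = _ := by
        refine lintegral_congr fun X => ?_
        rw [lintegral_const_mul]
        exact hm2.comp measurable_prodMk_left

lemma div_add_le_lintegral {R x : ℝ} (hR : 0 < R) (hx : 0 < x) :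
    ENNReal.ofReal (R / (R + x)) ≤
      ∫⁻ u in Set.Ioc (0 : ℝ) 1, ENNReal.ofReal ((u⁻¹ * R) ^ 2 / ((u⁻¹ * R) ^ 2 + x ^ 2)) := by
  have hcont : ContinuousOn (fun u : ℝ => R ^ 2 / (R + u * x) ^ 2) (Set.Icc 0 1) := by
    refine ContinuousOn.div (by fun_prop) (by fun_prop) fun u hu => ?_
    have := hu.1
    positivity
  have hint : ∫ u in (0 : ℝ)..1, R ^ 2 / (R + u * x) ^ 2 = R / (R + x) := by
    rw [intervalIntegral.integral_eq_sub_of_hasDerivAt (f := fun u : ℝ => u * R / (R + u * x))]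
    · simp
    · intro u hu
      rw [Set.uIcc_of_le zero_le_one] at hu
      have hu0 := hu.1
      have hne : R + u * x ≠ 0 := by positivity
      have h1 : HasDerivAt (fun u : ℝ => u * R) R u := by
        simpa using (hasDerivAt_id u).mul_const R
      have h2 : HasDerivAt (fun u : ℝ => R + u * x) x u := by
        simpa using ((hasDerivAt_id u).mul_const x).const_add R
      refine (h1.div h2 hne).congr_deriv ?_
      field_simp; ring
    · refine ContinuousOn.intervalIntegrable ?_
      rwa [Set.uIcc_of_le zero_le_one]
  rw [← hint, intervalIntegral.integral_of_le zero_le_one, ofReal_integral_eq_lintegral_ofReal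
    (hcont.integrableOn_Icc.mono_set Set.Ioc_subset_Icc_self) (ae_of_all _ fun u => by positivity)]
  refine setLIntegral_mono' measurableSet_Ioc fun u hu => ENNReal.ofReal_le_ofReal ?_
  have hu0 : 0 < u := hu.1
  have e : (u⁻¹ * R) ^ 2 / ((u⁻¹ * R) ^ 2 + x ^ 2) = R ^ 2 / (R ^ 2 + (u * x) ^ 2) := by
    field_simp
  rw [e]
  gcongr
  nlinarith [mul_pos hR (mul_pos hu0 hx)]

/-- The radial estimate behind the lower bound on the eigenvalues of `Q`. -/
lemma le_integral_norm_sq_div_ballPert {d : ℕ} (hd : 2 ≤ d) [IsProbabilityMeasure (ballPert d)]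
    {x : ℝ} (hx : 0 < x) :
    1 / (x + 2) ≤ ∫ ξ, ‖ξ‖ ^ 2 / (‖ξ‖ ^ 2 + x ^ 2) ∂(ballPert d) := by
  have hc := continuous_studentProfile d
  have i0 := integrable_norm_pow_mul_studentProfile hd (k := 0) (by norm_num)
  simp only [pow_zero, one_mul] at i0
  have hcnn := ftildeConst_nonneg d
  have hpnn := studentProfile_nonneg d
  have hone : 2 * ftildeConst d * ∫ X : E d, studentProfile d ‖X‖ = 1 := by
    have h := lintegral_ballPert hd (G := fun _ => 1) measurable_const
    simp only [lintegral_one, measure_univ, Measure.restrict_apply_univ, Real.volume_Ioc, sub_zero,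
      ENNReal.ofReal_one, mul_one] at h
    rw [← ofReal_integral_eq_lintegral_ofReal (i0.const_mul _)
      (ae_of_all _ fun X => mul_nonneg (by positivity) (hpnn _)), integral_const_mul] at h
    exact (ENNReal.ofReal_eq_one.1 h.symm)
  have hcontG : Continuous fun ξ : E d => ‖ξ‖ ^ 2 / (‖ξ‖ ^ 2 + x ^ 2) :=
    Continuous.div₀ (by fun_prop) (by fun_prop) fun ξ => by positivity
  have i3 : Integrable (fun X : E d => ‖X‖ / (‖X‖ + x) * studentProfile d ‖X‖) := by
    refine i0.mono' ?_ (ae_of_all _ fun X => ?_)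
    · refine Continuous.aestronglyMeasurable ?_
      refine (continuous_norm.div₀ (by fun_prop) fun X => ?_).mul (by fun_prop)
      positivity
    · have hp := hpnn ‖X‖
      rw [Real.norm_of_nonneg (by positivity)]
      refine mul_le_of_le_one_left hp ?_
      rw [div_le_one (by positivity)]; linarith
  have hlow : ENNReal.ofReal (1 / (x + 2)) ≤
      ∫⁻ ξ, ENNReal.ofReal (‖ξ‖ ^ 2 / (‖ξ‖ ^ 2 + x ^ 2)) ∂(ballPert d) := by
    rw [lintegral_ballPert hd (G := fun ξ => ENNReal.ofReal (‖ξ‖ ^ 2 / (‖ξ‖ ^ 2 + x ^ 2)))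
      (ENNReal.measurable_ofReal.comp hcontG.measurable)]
    calc ENNReal.ofReal (1 / (x + 2))
        ≤ ENNReal.ofReal (∫ X : E d,
            2 * ftildeConst d * (‖X‖ / (‖X‖ + x) * studentProfile d ‖X‖)) := by
          refine ENNReal.ofReal_le_ofReal ?_
          rw [integral_const_mul]
          have := mul_le_mul_of_nonneg_left (le_integral_norm_div_mul_studentProfile hd hx)
            (by positivity : 0 ≤ 2 * ftildeConst d)
          rwa [← mul_div_assoc, hone] at this
      _ = ∫⁻ X : E d, ENNReal.ofReal
            (2 * ftildeConst d * (‖X‖ / (‖X‖ + x) * studentProfile d ‖X‖)) :=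
          ofReal_integral_eq_lintegral_ofReal (i3.const_mul _) (ae_of_all _ fun X => by
            have := hpnn ‖X‖
            simp only [Pi.zero_apply]
            positivity)
      _ ≤ _ := by
          refine lintegral_mono fun X => ?_
          have hp := hpnn ‖X‖
          rcases eq_or_ne X 0 with rfl | hX
          · simp
          · rw [mul_left_comm, mul_comm (‖X‖ / _), ENNReal.ofReal_mul (by positivity)]
            refine mul_le_mul_right ((div_add_le_lintegral (norm_pos_iff.2 hX) hx).trans_eq ?_) _
            refine setLIntegral_congr_fun measurableSet_Ioc fun u hu => ?_
            have hu0 : 0 < u := hu.1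
            simp only [norm_smul, Real.norm_of_nonneg (inv_pos.2 hu0).le]
  have hfin : Integrable (fun ξ : E d => ‖ξ‖ ^ 2 / (‖ξ‖ ^ 2 + x ^ 2)) (ballPert d) := by
    refine Integrable.of_bound hcontG.aestronglyMeasurable 1 (ae_of_all _ fun ξ => ?_)
    rw [Real.norm_of_nonneg (by positivity), div_le_one (by positivity)]
    nlinarith
  rw [← ofReal_integral_eq_lintegral_ofReal hfin (ae_of_all _ fun ξ => by positivity)] at hlow
  exact (ENNReal.ofReal_le_ofReal_iff (integral_nonneg fun ξ => by positivity)).1 hlow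

lemma measurePreserving_ballPert {d : ℕ} (ρ : E d ≃ₗᵢ[ℝ] E d) :
    MeasurePreserving ρ (ballPert d) (ballPert d) := by
  refine ⟨ρ.continuous.measurable, ?_⟩
  ext s hs
  have hpre := ρ.continuous.measurable hs
  rw [Measure.map_apply ρ.continuous.measurable hs, ballPert, withDensity_apply _ hs,
    withDensity_apply _ hpre, ← ρ.measurePreserving.setLIntegral_comp_preimage_emb
      ρ.toHomeomorph.measurableEmbedding (fun x => ENNReal.ofReal (fball d x)) s]
  simp only [fball, ρ.norm_map]

section Isotropic

variable {d : ℕ} {ν : Measure (E d)}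

lemma exists_isometry_fixing {θ v w : E d} (hv : ⟪θ, v⟫ = 0) (hw : ⟪θ, w⟫ = 0) (h : ‖v‖ = ‖w‖) :
    ∃ ρ : E d ≃ₗᵢ[ℝ] E d, ρ θ = θ ∧ ρ v = w := by
  refine ⟨(Submodule.span ℝ {v - w})ᗮ.reflection, ?_, Submodule.reflection_sub h⟩
  refine Submodule.reflection_mem_subspace_eq_self ?_
  rw [Submodule.mem_orthogonal_singleton_iff_inner_left, inner_sub_right, hv, hw, sub_zero]

lemma integral_comp_isometry (hν : ∀ ρ : E d ≃ₗᵢ[ℝ] E d, MeasurePreserving ρ ν ν)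
    (ρ : E d ≃ₗᵢ[ℝ] E d) (F : E d → ℝ) : ∫ ξ, F (ρ ξ) ∂ν = ∫ ξ, F ξ ∂ν :=
  (hν ρ).integral_comp ρ.toHomeomorph.measurableEmbedding F

/-- The direction of the perturbed vector `θ + ξ`. -/
def perturbedDir (θ ξ : E d) : E d := ‖θ + ξ‖⁻¹ • (θ + ξ)

lemma measurable_perturbedDir (θ : E d) : Measurable (perturbedDir θ) := by
  unfold perturbedDir
  fun_prop

lemma norm_perturbedDir_le_one (θ ξ : E d) : ‖perturbedDir θ ξ‖ ≤ 1 := by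
  rw [perturbedDir, norm_smul, norm_inv, norm_norm]
  exact inv_mul_le_one

lemma perturbedDir_isometry {θ : E d} {ρ : E d ≃ₗᵢ[ℝ] E d} (h : ρ θ = θ) (ξ : E d) :
    perturbedDir θ (ρ ξ) = ρ (perturbedDir θ ξ) := by
  have : θ + ρ ξ = ρ (θ + ξ) := by rw [map_add, h]
  rw [perturbedDir, this, ρ.norm_map, perturbedDir, map_smul]

/-- The second moment form `(v, w) ↦ E[⟨v, A⟩ ⟨w, A⟩]` of `A = perturbedDir θ ξ`. -/
def dirMoment (ν : Measure (E d)) (θ v w : E d) : ℝ :=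
  ∫ ξ, ⟪v, perturbedDir θ ξ⟫ * ⟪w, perturbedDir θ ξ⟫ ∂ν

lemma integrable_dirMoment [IsFiniteMeasure ν] (θ v w : E d) :
    Integrable (fun ξ => ⟪v, perturbedDir θ ξ⟫ * ⟪w, perturbedDir θ ξ⟫) ν := by
  have hm := measurable_perturbedDir θ
  refine Integrable.of_bound (by fun_prop) (‖v‖ * ‖w‖) (ae_of_all _ fun ξ => ?_)
  have h := norm_perturbedDir_le_one θ ξ
  rw [norm_mul]
  exact mul_le_mul
    ((norm_inner_le_norm _ _).trans (mul_le_of_le_one_right (norm_nonneg _) h))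
    ((norm_inner_le_norm _ _).trans (mul_le_of_le_one_right (norm_nonneg _) h))
    (norm_nonneg _) (norm_nonneg _)

lemma dirMoment_comm (θ v w : E d) : dirMoment ν θ v w = dirMoment ν θ w v := by
  simp only [dirMoment, mul_comm]

lemma dirMoment_add_left [IsFiniteMeasure ν] (θ u v w : E d) :
    dirMoment ν θ (u + v) w = dirMoment ν θ u w + dirMoment ν θ v w := by
  simp only [dirMoment, inner_add_left, add_mul]
  exact integral_add (integrable_dirMoment θ u w) (integrable_dirMoment θ v w)

lemma dirMoment_smul_left (θ v w : E d) (a : ℝ) :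
    dirMoment ν θ (a • v) w = a * dirMoment ν θ v w := by
  simp only [dirMoment, real_inner_smul_left, mul_assoc]
  exact integral_const_mul _ _

lemma dirMoment_add_right [IsFiniteMeasure ν] (θ u v w : E d) :
    dirMoment ν θ u (v + w) = dirMoment ν θ u v + dirMoment ν θ u w := by
  rw [dirMoment_comm, dirMoment_add_left, dirMoment_comm θ v, dirMoment_comm θ w]

lemma dirMoment_smul_right (θ v w : E d) (a : ℝ) :
    dirMoment ν θ v (a • w) = a * dirMoment ν θ v w := by
  rw [dirMoment_comm, dirMoment_smul_left, dirMoment_comm]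

lemma dirMoment_isometry (hν : ∀ ρ : E d ≃ₗᵢ[ℝ] E d, MeasurePreserving ρ ν ν) {θ : E d}
    {ρ : E d ≃ₗᵢ[ℝ] E d} (h : ρ θ = θ) (v w : E d) :
    dirMoment ν θ (ρ v) (ρ w) = dirMoment ν θ v w := by
  rw [dirMoment, ← integral_comp_isometry hν ρ]
  simp only [perturbedDir_isometry h, ρ.inner_map_map]
  rfl

lemma dirMoment_orthogonal_eq_zero (hν : ∀ ρ : E d ≃ₗᵢ[ℝ] E d, MeasurePreserving ρ ν ν)
    {θ v : E d} (hv : ⟪θ, v⟫ = 0) : dirMoment ν θ θ v = 0 := by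
  obtain ⟨ρ, hρθ, hρv⟩ := exists_isometry_fixing (w := -v) hv (by simp [hv]) (norm_neg v).symm
  have h := dirMoment_isometry hν hρθ θ v
  rw [hρθ, hρv, ← neg_one_smul ℝ v, dirMoment_smul_right] at h
  linarith

lemma dirMoment_orthogonal_self (hν : ∀ ρ : E d ≃ₗᵢ[ℝ] E d, MeasurePreserving ρ ν ν)
    {θ e v : E d} (he : ⟪θ, e⟫ = 0) (he1 : ‖e‖ = 1) (hv : ⟪θ, v⟫ = 0) :
    dirMoment ν θ v v = dirMoment ν θ e e * ‖v‖ ^ 2 := by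
  obtain ⟨ρ, hρθ, hρv⟩ := exists_isometry_fixing (v := ‖v‖ • e) (w := v)
    (by rw [real_inner_smul_right, he, mul_zero]) hv (by simp [norm_smul, he1])
  have h := dirMoment_isometry hν hρθ (‖v‖ • e) (‖v‖ • e)
  rw [hρv, dirMoment_smul_left, dirMoment_smul_right] at h
  rw [h]; ring

lemma dirMoment_orthogonal [IsFiniteMeasure ν]
    (hν : ∀ ρ : E d ≃ₗᵢ[ℝ] E d, MeasurePreserving ρ ν ν)
    {θ e v w : E d} (he : ⟪θ, e⟫ = 0) (he1 : ‖e‖ = 1) (hv : ⟪θ, v⟫ = 0) (hw : ⟪θ, w⟫ = 0) :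
    dirMoment ν θ v w = dirMoment ν θ e e * ⟪v, w⟫ := by
  have h := dirMoment_orthogonal_self hν he he1 (v := v + w) (by rw [inner_add_right, hv, hw, add_zero])
  rw [dirMoment_add_left, dirMoment_add_right, dirMoment_add_right, dirMoment_comm θ w v,
    dirMoment_orthogonal_self hν he he1 hv, dirMoment_orthogonal_self hν he he1 hw,
    norm_add_sq_real] at h
  linarith

/-- The second moment form of the perturbed direction has only two eigenvalues. -/
lemma dirMoment_eq [IsFiniteMeasure ν]
    (hν : ∀ ρ : E d ≃ₗᵢ[ℝ] E d, MeasurePreserving ρ ν ν)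
    {θ e : E d} (hθ : θ ≠ 0) (he : ⟪θ, e⟫ = 0) (he1 : ‖e‖ = 1) (v w : E d) :
    dirMoment ν θ v w =
      dirMoment ν θ e e * (⟪v, w⟫ - ⟪θ, v⟫ * ⟪θ, w⟫ / ‖θ‖ ^ 2) +
        dirMoment ν θ θ θ / ‖θ‖ ^ 2 * (⟪θ, v⟫ * ⟪θ, w⟫ / ‖θ‖ ^ 2) := by
  have hn : ‖θ‖ ≠ 0 := norm_ne_zero_iff.2 hθ
  have hperp : ∀ u : E d, ⟪θ, u - (⟪θ, u⟫ / ‖θ‖ ^ 2) • θ⟫ = 0 := fun u => by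
    rw [inner_sub_right, real_inner_smul_right, real_inner_self_eq_norm_sq]
    field_simp; ring
  have hdec : ∀ u : E d, u = (⟪θ, u⟫ / ‖θ‖ ^ 2) • θ + (u - (⟪θ, u⟫ / ‖θ‖ ^ 2) • θ) :=
    fun u => by abel
  have hvw : ⟪v - (⟪θ, v⟫ / ‖θ‖ ^ 2) • θ, w - (⟪θ, w⟫ / ‖θ‖ ^ 2) • θ⟫ =
      ⟪v, w⟫ - ⟪θ, v⟫ * ⟪θ, w⟫ / ‖θ‖ ^ 2 := by
    rw [inner_sub_left, real_inner_smul_left, hperp, inner_sub_right, real_inner_smul_right,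
      real_inner_comm θ v]
    ring
  conv_lhs => rw [hdec v, hdec w]
  rw [dirMoment_add_left, dirMoment_add_right, dirMoment_add_right, dirMoment_smul_left,
    dirMoment_smul_left, dirMoment_smul_right, dirMoment_smul_right,
    dirMoment_orthogonal_eq_zero hν (hperp w), dirMoment_comm θ (v - _) θ,
    dirMoment_orthogonal_eq_zero hν (hperp v), dirMoment_orthogonal hν he he1 (hperp v) (hperp w),
    hvw]
  ring

lemma integral_inner_sq_mul_radial (hν : ∀ ρ : E d ≃ₗᵢ[ℝ] E d, MeasurePreserving ρ ν ν)
    {k : ℝ → ℝ} (hk : Measurable k) (hint : Integrable (fun ξ => ‖ξ‖ ^ 2 * k ‖ξ‖) ν) (e : E d) :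
    d * ∫ ξ, ⟪e, ξ⟫ ^ 2 * k ‖ξ‖ ∂ν = ‖e‖ ^ 2 * ∫ ξ, ‖ξ‖ ^ 2 * k ‖ξ‖ ∂ν := by
  have hi : ∀ v : E d, Integrable (fun ξ => ⟪v, ξ⟫ ^ 2 * k ‖ξ‖) ν := fun v => by
    refine (hint.const_mul (‖v‖ ^ 2)).mono (by fun_prop) (ae_of_all _ fun ξ => ?_)
    rw [← mul_assoc, norm_mul, norm_mul, ← mul_pow, norm_pow, norm_pow]
    gcongr
    simpa using norm_inner_le_norm (𝕜 := ℝ) v ξ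
  have hb : ∀ i, ∫ ξ, ⟪‖e‖ • EuclideanSpace.basisFun (Fin d) ℝ i, ξ⟫ ^ 2 * k ‖ξ‖ ∂ν =
      ∫ ξ, ⟪e, ξ⟫ ^ 2 * k ‖ξ‖ ∂ν := fun i => by
    obtain ⟨ρ, -, hρ⟩ := exists_isometry_fixing (θ := 0)
      (v := ‖e‖ • EuclideanSpace.basisFun (Fin d) ℝ i) (w := e) (by simp) (by simp)
      (by simp [norm_smul])
    conv_rhs => rw [← hρ, ← integral_comp_isometry hν ρ]
    simp only [ρ.inner_map_map, ρ.norm_map]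
  have hsum : ∑ i : Fin d, ∫ ξ, ⟪‖e‖ • EuclideanSpace.basisFun (Fin d) ℝ i, ξ⟫ ^ 2 * k ‖ξ‖ ∂ν =
      ‖e‖ ^ 2 * ∫ ξ, ‖ξ‖ ^ 2 * k ‖ξ‖ ∂ν := by
    rw [← integral_finsetSum _ fun i _ => hi _, ← integral_const_mul]
    refine integral_congr_ae (ae_of_all _ fun ξ => ?_)
    simp only [real_inner_smul_left, mul_pow]
    rw [← Finset.sum_mul, ← Finset.mul_sum, mul_assoc,
      ← (EuclideanSpace.basisFun (Fin d) ℝ).sum_sq_inner_right ξ]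
  rw [← hsum, Finset.sum_congr rfl fun i _ => hb i]
  simp

lemma integral_add_comp_neg (hν : ∀ ρ : E d ≃ₗᵢ[ℝ] E d, MeasurePreserving ρ ν ν)
    {F : E d → ℝ} (hF : Integrable F ν) : ∫ ξ, (F ξ + F (-ξ)) ∂ν = 2 * ∫ ξ, F ξ ∂ν := by
  have hmp := hν (LinearIsometryEquiv.neg ℝ)
  have hF' : Integrable (fun ξ => F (-ξ)) ν :=
    (hmp.integrable_comp_emb (LinearIsometryEquiv.neg ℝ).toHomeomorph.measurableEmbedding).2 hF
  rw [integral_add hF hF', two_mul]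
  exact congrArg _ (integral_comp_isometry hν (LinearIsometryEquiv.neg ℝ) F)

lemma inner_perturbedDir_sq (θ v ξ : E d) :
    ⟪v, perturbedDir θ ξ⟫ * ⟪v, perturbedDir θ ξ⟫ = (⟪v, θ⟫ + ⟪v, ξ⟫) ^ 2 / ‖θ + ξ‖ ^ 2 := by
  rw [perturbedDir, real_inner_smul_right, inner_add_right]
  field_simp

lemma two_mul_div_le_add_of_orthogonal {θ e : E d} (hθ : θ ≠ 0) (he : ⟪θ, e⟫ = 0) (ξ : E d) :
    2 * (⟪e, ξ⟫ ^ 2 * (1 / (‖ξ‖ ^ 2 + ‖θ‖ ^ 2))) ≤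
      ⟪e, perturbedDir θ ξ⟫ * ⟪e, perturbedDir θ ξ⟫ +
        ⟪e, perturbedDir θ (-ξ)⟫ * ⟪e, perturbedDir θ (-ξ)⟫ := by
  have hn := norm_pos_iff.2 hθ
  rw [inner_perturbedDir_sq, inner_perturbedDir_sq, real_inner_comm θ e, he, inner_neg_right, zero_add,
    zero_add, neg_sq]
  by_cases h1 : θ + ξ = 0
  · have : ⟪e, ξ⟫ = 0 := by
      rw [← neg_eq_of_add_eq_zero_right h1, inner_neg_right, real_inner_comm θ e, he, neg_zero]
    simp [this]
  by_cases h2 : θ + -ξ = 0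
  · have : ⟪e, ξ⟫ = 0 := by
      rw [← add_neg_eq_zero.1 h2, real_inner_comm θ e, he]
    simp [this]
  have p1 := pow_pos (norm_pos_iff.2 h1) 2
  have p2 := pow_pos (norm_pos_iff.2 h2) 2
  have e1 : ‖θ + ξ‖ ^ 2 + ‖θ + -ξ‖ ^ 2 = 2 * (‖ξ‖ ^ 2 + ‖θ‖ ^ 2) := by
    rw [norm_add_sq_real, norm_add_sq_real, inner_neg_right, norm_neg]; ring
  set a := ‖θ + ξ‖ ^ 2
  set b := ‖θ + -ξ‖ ^ 2
  have e2 : ‖ξ‖ ^ 2 + ‖θ‖ ^ 2 = (a + b) / 2 := by linarith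
  have key : 2 * (1 / ((a + b) / 2)) ≤ 1 / a + 1 / b := by
    rw [div_add_div _ _ p1.ne' p2.ne', one_div_div, ← mul_div_assoc,
      div_le_div_iff₀ (by positivity) (by positivity)]
    nlinarith [sq_nonneg (a - b), mul_pos p1 p2]
  have := mul_le_mul_of_nonneg_left key (sq_nonneg ⟪e, ξ⟫)
  rw [e2]
  calc _ = ⟪e, ξ⟫ ^ 2 * (2 * (1 / ((a + b) / 2))) := by ring
    _ ≤ _ := this
    _ = _ := by ring

lemma inner_sq_div_le_of_nonneg {θ ξ : E d} (hθ : θ ≠ 0) (hs : 0 ≤ ⟪θ, ξ⟫) :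
    ⟪θ, ξ⟫ ^ 2 * (‖ξ‖ ^ 2)⁻¹ ≤ ⟪θ, perturbedDir θ ξ⟫ * ⟪θ, perturbedDir θ ξ⟫ := by
  have hn := pow_pos (norm_pos_iff.2 hθ) 2
  rw [inner_perturbedDir_sq, real_inner_self_eq_norm_sq, norm_add_sq_real]
  rcases eq_or_ne ξ 0 with rfl | hξ
  · simp; positivity
  have hr := pow_pos (norm_pos_iff.2 hξ) 2
  have hcs : ⟪θ, ξ⟫ ^ 2 ≤ ‖θ‖ ^ 2 * ‖ξ‖ ^ 2 := by
    rw [← mul_pow, sq_le_sq₀ hs (by positivity)]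
    exact real_inner_le_norm θ ξ
  rw [← div_eq_mul_inv, div_le_div_iff₀ hr (by positivity)]
  nlinarith [mul_nonneg (by positivity : 0 ≤ ‖θ‖ ^ 2 + 2 * ⟪θ, ξ⟫) (sub_nonneg.2 hcs)]

lemma inner_sq_div_le_add {θ : E d} (hθ : θ ≠ 0) (ξ : E d) :
    ⟪θ, ξ⟫ ^ 2 * (‖ξ‖ ^ 2)⁻¹ ≤
      ⟪θ, perturbedDir θ ξ⟫ * ⟪θ, perturbedDir θ ξ⟫ +
        ⟪θ, perturbedDir θ (-ξ)⟫ * ⟪θ, perturbedDir θ (-ξ)⟫ := by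
  rcases le_total 0 ⟪θ, ξ⟫ with h | h
  · exact (inner_sq_div_le_of_nonneg hθ h).trans (le_add_of_nonneg_right (mul_self_nonneg _))
  · have := inner_sq_div_le_of_nonneg (ξ := -ξ) hθ (by rw [inner_neg_right]; linarith)
    rw [inner_neg_right, neg_sq, norm_neg] at this
    exact this.trans (le_add_of_nonneg_left (mul_self_nonneg _))

lemma integral_norm_sq_div_le_dirMoment [IsFiniteMeasure ν]
    (hν : ∀ ρ : E d ≃ₗᵢ[ℝ] E d, MeasurePreserving ρ ν ν)
    {θ e : E d} (hθ : θ ≠ 0) (he : ⟪θ, e⟫ = 0) (he1 : ‖e‖ = 1) :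
    ∫ ξ, ‖ξ‖ ^ 2 / (‖ξ‖ ^ 2 + ‖θ‖ ^ 2) ∂ν ≤ d * dirMoment ν θ e e := by
  have hn := norm_pos_iff.2 hθ
  have hint : Integrable (fun ξ => ‖ξ‖ ^ 2 * (1 / (‖ξ‖ ^ 2 + ‖θ‖ ^ 2))) ν := by
    refine Integrable.of_bound (by fun_prop) 1 (ae_of_all _ fun ξ => ?_)
    rw [mul_one_div, Real.norm_of_nonneg (by positivity), div_le_one (by positivity)]
    nlinarith
  have h := integral_inner_sq_mul_radial hν (k := fun r => 1 / (r ^ 2 + ‖θ‖ ^ 2))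
    (by fun_prop) hint e
  rw [he1, one_pow, one_mul] at h
  simp only [mul_one_div _ (_ + _)] at h
  rw [← h]
  refine mul_le_mul_of_nonneg_left ?_ (Nat.cast_nonneg d)
  have hF := integrable_dirMoment (ν := ν) θ e e
  have hmono : ∫ ξ, 2 * (⟪e, ξ⟫ ^ 2 * (1 / (‖ξ‖ ^ 2 + ‖θ‖ ^ 2))) ∂ν ≤ _ :=
    integral_mono_of_nonneg (ae_of_all _ fun ξ => by simp only [Pi.zero_apply]; positivity)
    (hF.add ((hν (LinearIsometryEquiv.neg ℝ)).integrable_comp_emb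
      (LinearIsometryEquiv.neg ℝ).toHomeomorph.measurableEmbedding |>.2 hF))
    (ae_of_all _ fun ξ => two_mul_div_le_add_of_orthogonal hθ he ξ)
  have hadd := integral_add_comp_neg hν hF
  rw [integral_const_mul] at hmono
  simp only [mul_one_div _ (_ + _)] at hmono
  have := hmono.trans_eq hadd
  unfold dirMoment
  linarith

lemma one_le_dirMoment_self [IsProbabilityMeasure ν] (h0 : ν {0} = 0)
    (hν : ∀ ρ : E d ≃ₗᵢ[ℝ] E d, MeasurePreserving ρ ν ν) {θ : E d} (hθ : θ ≠ 0) :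
    1 ≤ 2 * d * (dirMoment ν θ θ θ / ‖θ‖ ^ 2) := by
  have hn := norm_pos_iff.2 hθ
  have hae : (fun ξ : E d => ‖ξ‖ ^ 2 * (‖ξ‖ ^ 2)⁻¹) =ᵐ[ν] fun _ => 1 := by
    have : ∀ᵐ ξ ∂ν, ξ ≠ 0 := by simpa [ae_iff] using h0
    filter_upwards [this] with ξ hξ
    exact mul_inv_cancel₀ (pow_ne_zero _ (norm_ne_zero_iff.2 hξ))
  have h := integral_inner_sq_mul_radial hν (k := fun r => (r ^ 2)⁻¹)
    (by fun_prop) ((integrable_const (1 : ℝ)).congr hae.symm) θ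
  rw [integral_congr_ae hae, integral_const, smul_eq_mul, mul_one, probReal_univ, mul_one] at h
  have hF := integrable_dirMoment (ν := ν) θ θ θ
  have hmono : ∫ ξ, ⟪θ, ξ⟫ ^ 2 * (‖ξ‖ ^ 2)⁻¹ ∂ν ≤ _ :=
    integral_mono_of_nonneg (ae_of_all _ fun ξ => by simp only [Pi.zero_apply]; positivity)
    (hF.add ((hν (LinearIsometryEquiv.neg ℝ)).integrable_comp_emb
      (LinearIsometryEquiv.neg ℝ).toHomeomorph.measurableEmbedding |>.2 hF))
    (ae_of_all _ fun ξ => inner_sq_div_le_add hθ ξ)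
  have h2 := mul_le_mul_of_nonneg_left (hmono.trans_eq (integral_add_comp_neg hν hF))
    (Nat.cast_nonneg (α := ℝ) d)
  rw [h] at h2
  rw [← mul_div_assoc, le_div_iff₀ (by positivity)]
  unfold dirMoment
  linarith

end Isotropic

section TwoEigenvalues

variable {n : Type*} [DecidableEq n]

/-- The matrix acting by `a` on the kernel and by `b` on the range of a projection `P`. -/
def twoEigen (P : Matrix n n ℝ) (a b : ℝ) : Matrix n n ℝ := a • (1 - P) + b • P

lemma twoEigen_transpose {P : Matrix n n ℝ} (hP : Pᵀ = P) (a b : ℝ) :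
    (twoEigen P a b)ᵀ = twoEigen P a b := by
  simp [twoEigen, hP]

variable [Fintype n]

lemma twoEigen_mul {P : Matrix n n ℝ} (hP : P * P = P) (a b a' b' : ℝ) :
    twoEigen P a b * twoEigen P a' b' = twoEigen P (a * a') (b * b') := by
  simp only [twoEigen, add_mul, mul_add, smul_mul_smul_comm, sub_mul, mul_sub, one_mul, mul_one, hP,
    sub_self, smul_zero, sub_zero, add_zero, zero_add]

lemma twoEigen_inv {P : Matrix n n ℝ} (hP : P * P = P) {a b : ℝ} (ha : a ≠ 0) (hb : b ≠ 0) :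
    (twoEigen P a b)⁻¹ = twoEigen P a⁻¹ b⁻¹ := by
  refine Matrix.inv_eq_right_inv ?_
  rw [twoEigen_mul hP, mul_inv_cancel₀ ha, mul_inv_cancel₀ hb]
  simp [twoEigen]

lemma dotProduct_twoEigen_mulVec (P : Matrix n n ℝ) (a b : ℝ) (v : n → ℝ) :
    v ⬝ᵥ twoEigen P a b *ᵥ v = a * (v ⬝ᵥ v - v ⬝ᵥ P *ᵥ v) + b * (v ⬝ᵥ P *ᵥ v) := by
  simp only [twoEigen, Matrix.add_mulVec, Matrix.smul_mulVec, Matrix.sub_mulVec, Matrix.one_mulVec,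
    dotProduct_add, dotProduct_smul, dotProduct_sub, smul_eq_mul]

lemma twoEigen_mulVec_dotProduct {P : Matrix n n ℝ} (hPP : P * P = P) (hPt : Pᵀ = P)
    (a b h k : ℝ) (v : n → ℝ) :
    (twoEigen P a b *ᵥ v) ⬝ᵥ twoEigen P h k *ᵥ (twoEigen P a b *ᵥ v) =
      h * a ^ 2 * (v ⬝ᵥ v - v ⬝ᵥ P *ᵥ v) + k * b ^ 2 * (v ⬝ᵥ P *ᵥ v) := by
  rw [dotProduct_comm, dotProduct_mulVec, ← Matrix.mulVec_transpose, twoEigen_transpose hPt,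
    Matrix.mulVec_mulVec, Matrix.mulVec_mulVec, twoEigen_mul hPP, twoEigen_mul hPP,
    dotProduct_comm, dotProduct_twoEigen_mulVec]
  ring

end TwoEigenvalues

section Estimator

variable {d : ℕ}

/-- The orthogonal projection onto the line spanned by `θ`. -/
def lineProj (θ : E d) : Matrix (Fin d) (Fin d) ℝ := (1 / ‖θ‖ ^ 2) • Matrix.vecMulVec θ θ

lemma dotProduct_eq_inner (v w : E d) : v ⬝ᵥ w = ⟪v, w⟫ := by
  simp [EuclideanSpace.inner_eq_star_dotProduct, dotProduct_comm]

lemma lineProj_mul_self {θ : E d} (hθ : θ ≠ 0) : lineProj θ * lineProj θ = lineProj θ := by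
  have hn := norm_ne_zero_iff.2 hθ
  rw [lineProj, smul_mul_smul_comm, Matrix.vecMulVec_mul_vecMulVec, dotProduct_eq_inner,
    real_inner_self_eq_norm_sq, Matrix.vecMulVec_smul, smul_smul]
  congr 1
  field_simp

lemma lineProj_transpose (θ : E d) : (lineProj θ)ᵀ = lineProj θ := by
  rw [lineProj, Matrix.transpose_smul, Matrix.transpose_vecMulVec]

lemma dotProduct_lineProj (θ v : E d) :
    v ⬝ᵥ lineProj θ *ᵥ v = ⟪θ, v⟫ ^ 2 / ‖θ‖ ^ 2 := by
  rw [lineProj, Matrix.smul_mulVec, Matrix.vecMulVec_mulVec, dotProduct_smul, op_smul_eq_smul,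
    dotProduct_smul, dotProduct_eq_inner, dotProduct_eq_inner, real_inner_comm, smul_eq_mul,
    smul_eq_mul]
  ring

lemma inner_sq_div_norm_sq_le (θ v : E d) : ⟪θ, v⟫ ^ 2 / ‖θ‖ ^ 2 ≤ ‖v‖ ^ 2 := by
  refine div_le_of_le_mul₀ (by positivity) (by positivity) ?_
  rw [← mul_pow, mul_comm, sq_le_sq, abs_of_nonneg (by positivity : 0 ≤ ‖θ‖ * ‖v‖)]
  exact abs_real_inner_le_norm θ v

lemma exists_norm_eq_one_inner_eq_zero (hd : 2 ≤ d) (θ : E d) : ∃ e : E d, ‖e‖ = 1 ∧ ⟪θ, e⟫ = 0 := by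
  have hs : 0 < Module.finrank ℝ (ℝ ∙ θ)ᗮ := by
    have h1 := (ℝ ∙ θ).finrank_add_finrank_orthogonal
    have h2 := finrank_span_le_card (R := ℝ) ({θ} : Set (E d))
    rw [Set.toFinset_singleton, Finset.card_singleton] at h2
    rw [finrank_euclideanSpace_fin] at h1
    omega
  have := Module.finrank_pos_iff.1 hs
  obtain ⟨e, he⟩ := exists_norm_eq (ℝ ∙ θ)ᗮ zero_le_one
  exact ⟨e, he, Submodule.mem_orthogonal_singleton_iff_inner_right.1 e.2⟩

variable {ν : Measure (E d)}

lemma integral_norm_perturbedDir_sq [IsFiniteMeasure ν]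
    (hν : ∀ ρ : E d ≃ₗᵢ[ℝ] E d, MeasurePreserving ρ ν ν)
    {θ e : E d} (hθ : θ ≠ 0) (he : ⟪θ, e⟫ = 0) (he1 : ‖e‖ = 1) :
    ∫ ξ, ‖perturbedDir θ ξ‖ ^ 2 ∂ν =
      dirMoment ν θ e e * (d - 1) + dirMoment ν θ θ θ / ‖θ‖ ^ 2 := by
  have hn := norm_ne_zero_iff.2 hθ
  let b := EuclideanSpace.basisFun (Fin d) ℝ
  have hsum : ∫ ξ, ‖perturbedDir θ ξ‖ ^ 2 ∂ν = ∑ i, dirMoment ν θ (b i) (b i) := by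
    simp only [dirMoment]
    rw [← integral_finsetSum _ fun i _ => integrable_dirMoment θ _ _]
    refine integral_congr_ae (ae_of_all _ fun ξ => ?_)
    simp only [← sq]
    exact (b.sum_sq_inner_right _).symm
  have hθb : ∑ i, ⟪θ, b i⟫ * ⟪θ, b i⟫ / ‖θ‖ ^ 2 = 1 := by
    simp only [← sq]
    rw [← Finset.sum_div, b.sum_sq_inner_left, div_self (pow_ne_zero 2 hn)]
  rw [hsum, Finset.sum_congr rfl fun i _ => dirMoment_eq hν hθ he he1 (b i) (b i),
    Finset.sum_add_distrib, ← Finset.mul_sum, ← Finset.mul_sum, Finset.sum_sub_distrib, hθb]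
  simp

/-- The quadratic form with eigenvalues `h`, `k` at the estimator built from
`A = perturbedDir θ ξ` and a second moment matrix with eigenvalues `α`, `β`. -/
def estimatorForm (θ y : E d) (α β h k : ℝ) (a : E d) : ℝ :=
  ⟪y, a⟫ ^ 2 * (h * α⁻¹ ^ 2 * (‖a‖ ^ 2 - ⟪θ, a⟫ ^ 2 / ‖θ‖ ^ 2) +
    k * β⁻¹ ^ 2 * (⟪θ, a⟫ ^ 2 / ‖θ‖ ^ 2))

lemma inner_sq_le_one {y a : E d} (hy : ‖y‖ ≤ 1) (ha : ‖a‖ ≤ 1) : ⟪y, a⟫ ^ 2 ≤ 1 := by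
  rw [sq_le_one_iff_abs_le_one]
  exact (abs_real_inner_le_norm y a).trans (mul_le_one₀ hy (norm_nonneg _) ha)

lemma estimatorForm_le_mul_add {y a : E d} (hy : ‖y‖ ≤ 1) (ha : ‖a‖ ≤ 1) (θ : E d) (α β : ℝ)
    {h k : ℝ} (hh : 0 ≤ h) (hk : 0 ≤ k) :
    estimatorForm θ y α β h k a ≤ h * α⁻¹ ^ 2 * (‖a‖ ^ 2 - ⟪θ, a⟫ ^ 2 / ‖θ‖ ^ 2) +
      k * β⁻¹ ^ 2 * (⟪θ, a⟫ ^ 2 / ‖θ‖ ^ 2) := by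
  have := sub_nonneg.2 (inner_sq_div_norm_sq_le θ a)
  exact mul_le_of_le_one_left (by positivity) (inner_sq_le_one hy ha)

lemma estimatorForm_nonneg (θ y a : E d) (α β : ℝ) {h k : ℝ} (hh : 0 ≤ h) (hk : 0 ≤ k) :
    0 ≤ estimatorForm θ y α β h k a := by
  have := sub_nonneg.2 (inner_sq_div_norm_sq_le θ a)
  unfold estimatorForm
  positivity

lemma estimatorForm_le {y a : E d} (hy : ‖y‖ ≤ 1) (ha : ‖a‖ ≤ 1) (θ : E d) {α β : ℝ}
    {h k : ℝ} (hh : 0 ≤ h) (hk : 0 ≤ k) {C : ℝ} (hC : h * α⁻¹ ^ 2 ≤ C) (hC' : k * β⁻¹ ^ 2 ≤ C) :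
    estimatorForm θ y α β h k a ≤ C := by
  refine (estimatorForm_le_mul_add hy ha θ α β hh hk).trans ?_
  have h0 : 0 ≤ ⟪θ, a⟫ ^ 2 / ‖θ‖ ^ 2 := by positivity
  have h1 := inner_sq_div_norm_sq_le θ a
  have h2 : ‖a‖ ^ 2 ≤ 1 := pow_le_one₀ (norm_nonneg _) ha
  have hC0 : 0 ≤ C := (by positivity : 0 ≤ h * α⁻¹ ^ 2).trans hC
  nlinarith [mul_le_mul_of_nonneg_right hC (sub_nonneg.2 h1), mul_le_mul_of_nonneg_right hC' h0]

lemma integral_estimatorForm_le [IsFiniteMeasure ν]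
    (hν : ∀ ρ : E d ≃ₗᵢ[ℝ] E d, MeasurePreserving ρ ν ν)
    {θ e y : E d} (hθ : θ ≠ 0) (he : ⟪θ, e⟫ = 0) (he1 : ‖e‖ = 1) (hy : ‖y‖ ≤ 1)
    {h k : ℝ} (hh : 0 ≤ h) (hk : 0 ≤ k) {α β : ℝ} (hα : α = dirMoment ν θ e e)
    (hβ : β = dirMoment ν θ θ θ / ‖θ‖ ^ 2) (hα0 : α ≠ 0) (hβ0 : β ≠ 0) :
    ∫ ξ, estimatorForm θ y α β h k (perturbedDir θ ξ) ∂ν ≤ h * (d - 1) * α⁻¹ + k * β⁻¹ := by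
  have hq : Integrable (fun ξ => ⟪θ, perturbedDir θ ξ⟫ ^ 2 / ‖θ‖ ^ 2) ν := by
    simp only [sq ⟪θ, perturbedDir θ _⟫]
    exact (integrable_dirMoment θ θ θ).div_const _
  have hA : Integrable (fun ξ => ‖perturbedDir θ ξ‖ ^ 2) ν := by
    have := measurable_perturbedDir θ
    refine Integrable.of_bound (by fun_prop) 1 (ae_of_all _ fun ξ => ?_)
    rw [norm_pow, norm_norm]
    exact pow_le_one₀ (norm_nonneg _) (norm_perturbedDir_le_one θ ξ)
  have hqi : ∫ ξ, ⟪θ, perturbedDir θ ξ⟫ ^ 2 / ‖θ‖ ^ 2 ∂ν = β := by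
    rw [integral_div, hβ]
    simp only [sq, dirMoment]
  have hAi := integral_norm_perturbedDir_sq hν hθ he he1
  rw [← hα, ← hβ] at hAi
  calc _ ≤ ∫ ξ, (h * α⁻¹ ^ 2 * (‖perturbedDir θ ξ‖ ^ 2 - ⟪θ, perturbedDir θ ξ⟫ ^ 2 / ‖θ‖ ^ 2) +
      k * β⁻¹ ^ 2 * (⟪θ, perturbedDir θ ξ⟫ ^ 2 / ‖θ‖ ^ 2)) ∂ν :=
        integral_mono_of_nonneg (ae_of_all _ fun ξ => estimatorForm_nonneg θ y _ α β hh hk)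
          (((hA.sub hq).const_mul _).add (hq.const_mul _)) (ae_of_all _ fun ξ =>
            estimatorForm_le_mul_add hy (norm_perturbedDir_le_one θ ξ) θ α β hh hk)
    _ = h * α⁻¹ ^ 2 * (α * (d - 1) + β - β) + k * β⁻¹ ^ 2 * β := by
        have hs : Integrable
            (fun ξ => ‖perturbedDir θ ξ‖ ^ 2 - ⟪θ, perturbedDir θ ξ⟫ ^ 2 / ‖θ‖ ^ 2) ν := hA.sub hq
        rw [integral_add (hs.const_mul _) (hq.const_mul _), integral_const_mul,
          integral_const_mul, integral_sub hA hq, hqi, hAi]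
    _ = _ := by field_simp; ring

lemma estimatorForm_eq {θ y a v : E d} {α β : ℝ} (hθ : θ ≠ 0) (hα : α ≠ 0) (hβ : β ≠ 0)
    {Q : Matrix (Fin d) (Fin d) ℝ} (hQ : Q = twoEigen (lineProj θ) α β)
    (hv : v = ⟪y, a⟫ • Q⁻¹.mulVec a) (h k : ℝ) :
    v ⬝ᵥ twoEigen (lineProj θ) h k *ᵥ v = estimatorForm θ y α β h k a := by
  have hP := lineProj_mul_self hθ
  rw [hv, hQ, twoEigen_inv hP hα hβ, Matrix.mulVec_smul, smul_dotProduct, dotProduct_smul,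
    twoEigen_mulVec_dotProduct hP (lineProj_transpose θ), dotProduct_lineProj, dotProduct_eq_inner,
    real_inner_self_eq_norm_sq, estimatorForm, smul_eq_mul, smul_eq_mul]
  ring

lemma eq_twoEigen_of_dirMoment [IsFiniteMeasure ν]
    (hν : ∀ ρ : E d ≃ₗᵢ[ℝ] E d, MeasurePreserving ρ ν ν)
    {θ e : E d} (hθ : θ ≠ 0) (he : ⟪θ, e⟫ = 0) (he1 : ‖e‖ = 1)
    {Q : Matrix (Fin d) (Fin d) ℝ}
    (hQ : ∀ i j, Q i j = ∫ ξ, perturbedDir θ ξ i * perturbedDir θ ξ j ∂ν) :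
    Q = twoEigen (lineProj θ) (dirMoment ν θ e e) (dirMoment ν θ θ θ / ‖θ‖ ^ 2) := by
  ext i j
  have h : Q i j = dirMoment ν θ (EuclideanSpace.single i 1) (EuclideanSpace.single j 1) := by
    rw [hQ, dirMoment]
    simp [EuclideanSpace.inner_single_left]
  rw [h, dirMoment_eq hν hθ he he1]
  simp [twoEigen, lineProj, Matrix.vecMulVec_apply, Matrix.one_apply,
    EuclideanSpace.inner_single_right, eq_comm (a := i), div_eq_inv_mul (θ i * θ j)]

/-- Operator norm and trace bounds for the form with the eigenvalues of the Hessian. -/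
lemma hessian_eigenvalue_bounds {D x a b h k : ℝ} (hD : 2 ≤ D) (hx : 0 < x) (ha0 : 0 ≤ a)
    (ha : a ≤ D * (x + 2)) (hb0 : 0 ≤ b) (hb : b ≤ 2 * D)
    (hh : h = (√(1 + x ^ 2) - 1) / x ^ 2) (hk : k = (√(1 + x ^ 2) - 1) / (x ^ 2 * √(1 + x ^ 2))) :
    0 ≤ h ∧ 0 ≤ k ∧ h * (D - 1) * a + k * b ≤ 3 / 2 * D ^ 2 ∧
      h * a ^ 2 ≤ D ^ 2 * x + 4 * D ^ 2 ∧ k * b ^ 2 ≤ D ^ 2 * x + 4 * D ^ 2 := by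
  have hw2 : √(1 + x ^ 2) ^ 2 = 1 + x ^ 2 := Real.sq_sqrt (by positivity)
  have hw1 : 1 ≤ √(1 + x ^ 2) := Real.one_le_sqrt.2 (by nlinarith)
  have hwx : x ≤ √(1 + x ^ 2) := Real.le_sqrt_of_sq_le (by linarith)
  set w := √(1 + x ^ 2)
  have hh' : h = 1 / (w + 1) := by
    rw [hh, div_eq_div_iff (by positivity) (by positivity)]; linarith
  have hk' : k = 1 / ((w + 1) * w) := by
    rw [hk, div_eq_div_iff (by positivity) (by positivity)]
    linear_combination w * hw2
  have hh0 : 0 ≤ h := by rw [hh']; positivity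
  have hk0 : 0 ≤ k := by rw [hk']; positivity
  have hk2 : k ≤ 1 / 2 := by
    rw [hk', div_le_div_iff₀ (by positivity) (by positivity)]; nlinarith
  have h1 : h * (x + 2) ≤ 3 / 2 := by
    rw [hh', one_div_mul_eq_div, div_le_iff₀ (by positivity)]; linarith
  have h2 : h * (x + 2) ^ 2 ≤ x + 4 := by
    rw [hh', one_div_mul_eq_div, div_le_iff₀ (by positivity)]; nlinarith
  refine ⟨hh0, hk0, ?_, ?_, ?_⟩
  · have e1 : h * (D - 1) * a ≤ (D * (D - 1)) * (3 / 2) :=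
      calc h * (D - 1) * a ≤ h * (D - 1) * (D * (x + 2)) := by
            have : 0 ≤ D - 1 := by linarith
            gcongr
        _ = (D * (D - 1)) * (h * (x + 2)) := by ring
        _ ≤ _ := mul_le_mul_of_nonneg_left h1 (by nlinarith)
    have e2 : k * b ≤ 1 / 2 * (2 * D) := mul_le_mul hk2 hb hb0 (by norm_num)
    nlinarith
  · calc h * a ^ 2 ≤ h * (D * (x + 2)) ^ 2 := by gcongr
      _ = D ^ 2 * (h * (x + 2) ^ 2) := by ring
      _ ≤ D ^ 2 * (x + 4) := by gcongr
      _ = _ := by ring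
  · calc k * b ^ 2 ≤ 1 / 2 * (2 * D) ^ 2 := by gcongr
      _ ≤ _ := by nlinarith [mul_nonneg (sq_nonneg D) hx.le]

end Estimator

/-- estimator bounds on the Euclidean ball.
For `ξ` with density `fball d`, `θ ≠ 0`, `‖y‖ ≤ 1`, with `A = (θ+ξ)/‖θ+ξ‖`,
`Q = E[AAᵀ]` (nonsingular), `ŷ = Q⁻¹A⟨y,A⟩` and `H = ∇²R*(θ)` as below:
(1) `E[ŷᵀHŷ] ≤ (3/2)d²`; (2) a.s. `ŷᵀHŷ ≤ d²‖θ‖ + 4d²`; (3) `E[‖ŷ‖²] ≤ d²‖θ‖ + 2d²`. -/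
theorem statement19 {d : ℕ} (hd : 2 ≤ d)
    {Ω : Type} [MeasurableSpace Ω] (μ : Measure Ω) [IsProbabilityMeasure μ]
    (ξ : Ω → E d) (hξmeas : Measurable ξ) (hξlaw : μ.map ξ = ballPert d)
    (θ : E d) (hθ : θ ≠ 0) (y : E d) (hy : ‖y‖ ≤ 1)
    (A : Ω → E d) (hA : ∀ ω, A ω = ‖θ + ξ ω‖⁻¹ • (θ + ξ ω))
    (Q : Matrix (Fin d) (Fin d) ℝ) (hQ : ∀ i j, Q i j = ∫ ω, A ω i * A ω j ∂μ)
    (hQns : IsUnit Q.det)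
    (yhat : Ω → E d) (hyhat : ∀ ω, yhat ω = ⟪y, A ω⟫ • Q⁻¹.mulVec (A ω))
    (P : Matrix (Fin d) (Fin d) ℝ) (hP : P = (1/‖θ‖^2) • Matrix.vecMulVec θ θ)
    (H : Matrix (Fin d) (Fin d) ℝ)
    (hH : H = ((Real.sqrt (1 + ‖θ‖^2) - 1) / ‖θ‖^2) •
          ((1 : Matrix (Fin d) (Fin d) ℝ) - P) +
        ((Real.sqrt (1 + ‖θ‖^2) - 1) / (‖θ‖^2 * Real.sqrt (1 + ‖θ‖^2))) • P) :
    (∫ ω, yhat ω ⬝ᵥ H.mulVec (yhat ω) ∂μ) ≤ 3/2 * (d : ℝ)^2 ∧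
    (∀ᵐ ω ∂μ, yhat ω ⬝ᵥ H.mulVec (yhat ω) ≤ (d : ℝ)^2 * ‖θ‖ + 4 * (d : ℝ)^2) ∧
    (∫ ω, ‖yhat ω‖^2 ∂μ) ≤ (d : ℝ)^2 * ‖θ‖ + 2 * (d : ℝ)^2 := by
  have hν := measurePreserving_ballPert (d := d)
  have hprob : IsProbabilityMeasure (ballPert d) :=
    hξlaw ▸ Measure.isProbabilityMeasure_map hξmeas.aemeasurable
  have hne := nontrivial_E hd
  have h0 : ballPert d {0} = 0 := withDensity_absolutelyContinuous _ _ (measure_singleton 0)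
  have hx := norm_pos_iff.2 hθ
  have hD : (2 : ℝ) ≤ d := by exact_mod_cast hd
  obtain ⟨e, he1, he⟩ := exists_norm_eq_one_inner_eq_zero hd θ
  obtain ⟨α, hα⟩ : ∃ α, α = dirMoment (ballPert d) θ e e := ⟨_, rfl⟩
  obtain ⟨β, hβ⟩ : ∃ β, β = dirMoment (ballPert d) θ θ θ / ‖θ‖ ^ 2 := ⟨_, rfl⟩
  have hα1 : 1 / (‖θ‖ + 2) ≤ d * α := by
    rw [hα]
    exact (le_integral_norm_sq_div_ballPert hd hx).trans
      (integral_norm_sq_div_le_dirMoment hν hθ he he1)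
  have hβ1 : 1 ≤ 2 * d * β := hβ ▸ one_le_dirMoment_self h0 hν hθ
  have hα0 : 0 < α := pos_of_mul_pos_right ((by positivity : 0 < 1 / (‖θ‖ + 2)).trans_le hα1)
    (by positivity)
  have hβ0 : 0 < β := pos_of_mul_pos_right (zero_lt_one.trans_le hβ1) (by positivity)
  have hα2 : α⁻¹ ≤ d * (‖θ‖ + 2) := by
    rw [inv_le_iff_one_le_mul₀ hα0]
    rw [div_le_iff₀ (by positivity)] at hα1
    linarith
  have hβ2 : β⁻¹ ≤ 2 * d := by rwa [inv_le_iff_one_le_mul₀ hβ0]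
  have hAξ : ∀ ω, A ω = perturbedDir θ (ξ ω) := hA
  have hmeas := measurable_perturbedDir θ
  have hQe : Q = twoEigen (lineProj θ) α β := by
    rw [hα, hβ]
    refine eq_twoEigen_of_dirMoment hν hθ he he1 fun i j => ?_
    rw [hQ, ← hξlaw, integral_map hξmeas.aemeasurable (by fun_prop)]
    simp only [hAξ]
  have hform : ∀ h k ω, yhat ω ⬝ᵥ twoEigen (lineProj θ) h k *ᵥ yhat ω =
      estimatorForm θ y α β h k (perturbedDir θ (ξ ω)) := fun h k ω => by
    rw [← hAξ]
    exact estimatorForm_eq hθ hα0.ne' hβ0.ne' hQe (hyhat ω) h k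
  have hint : ∀ h k, 0 ≤ h → 0 ≤ k →
      ∫ ω, yhat ω ⬝ᵥ twoEigen (lineProj θ) h k *ᵥ yhat ω ∂μ ≤ h * (d - 1) * α⁻¹ + k * β⁻¹ := by
    intro h k hh hk
    refine le_trans (le_of_eq ?_)
      (integral_estimatorForm_le hν hθ he he1 hy hh hk hα hβ hα0.ne' hβ0.ne')
    simp only [hform]
    rw [← hξlaw, integral_map hξmeas.aemeasurable]
    unfold estimatorForm
    fun_prop
  obtain ⟨hh, hk, b1, b2, b3⟩ := hessian_eigenvalue_bounds hD hx (inv_nonneg.2 hα0.le) hα2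
    (inv_nonneg.2 hβ0.le) hβ2 rfl rfl
  replace hH : H = twoEigen (lineProj θ) _ _ := hP ▸ hH
  rw [hH]
  refine ⟨(hint _ _ hh hk).trans b1, ae_of_all _ fun ω => ?_, ?_⟩
  · rw [hform]
    exact estimatorForm_le hy (norm_perturbedDir_le_one θ _) θ hh hk b2 b3
  · have h1 := hint 1 1 zero_le_one zero_le_one
    have hone : twoEigen (lineProj θ) 1 1 = 1 := by simp [twoEigen]
    simp only [hone, Matrix.one_mulVec, dotProduct_eq_inner, real_inner_self_eq_norm_sq] at h1
    refine h1.trans ?_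
    nlinarith [mul_le_mul_of_nonneg_left hα2 (by linarith : (0 : ℝ) ≤ d - 1)]
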